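/- arXiv:2312.14503 — 4 statements merged into one kernel-verified Lean document; each statement's English description precedes it below -/
import Mathlib

section
/- For every C ∈ ℝ and every θ ∈ ℝ, the characteristic polynomial of the 3 × 3 complex matrix Â(θ) := M · D(θ) · M⁻¹ · R equals the amplification polynomial: det(z·Id − Â(θ)) = z³ + a(θ)·z² − conj(a(θ))·z − 1, where M = [[1,1,1],[0,1,−1],[−2,1,1]], D(θ) = diag(1, e^{−Iθ}, e^{Iθ}), and R = [[1,0,0],[2C,−1,0],[2(2C²−1),0,−1]]. -/
/-- The coefficient `a(θ)` of the amplification polynomial of the fourth-order scheme. -/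
noncomputable def amplA (C θ : ℝ) : ℂ :=
  -(1/3 : ℂ) * (1 - 4 * (C : ℂ)^2 + 4 * ((C : ℂ)^2 - 1) * (Real.cos θ : ℂ)
    - 6 * Complex.I * (C : ℂ) * (Real.sin θ : ℂ))

/-- The moment matrix. -/
noncomputable def Mmat : Matrix (Fin 3) (Fin 3) ℂ := !![1, 1, 1; 0, 1, -1; -2, 1, 1]

/-- The streaming (diagonal) matrix in Fourier space. -/
noncomputable def Dmat (θ : ℝ) : Matrix (Fin 3) (Fin 3) ℂ :=
  Matrix.diagonal ![1, Complex.exp (-(Complex.I * θ)), Complex.exp (Complex.I * θ)]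

/-- The relaxation matrix. -/
noncomputable def Rmat (C : ℝ) : Matrix (Fin 3) (Fin 3) ℂ :=
  !![1, 0, 0; 2 * (C : ℂ), -1, 0; 2 * (2 * (C : ℂ)^2 - 1), 0, -1]

/-- The Fourier symbol of the lattice Boltzmann scheme. -/
noncomputable def Ahat (C θ : ℝ) : Matrix (Fin 3) (Fin 3) ℂ :=
  Mmat * Dmat θ * Mmat⁻¹ * Rmat C

lemma Mmat_inv_eq : Mmat⁻¹ =
    !![1/3, 0, -1/3; 1/3, 1/2, 1/6; 1/3, -1/2, 1/6] := by
  apply Matrix.inv_eq_right_inv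
  unfold Mmat
  ext i j
  fin_cases i <;> fin_cases j <;> simp [Matrix.mul_apply, Fin.sum_univ_three] <;> norm_num

/-- The characteristic polynomial of the Fourier symbol of the lattice Boltzmann scheme is the
amplification polynomial `z³ + a(θ)z² − conj(a(θ))z − 1`. -/
theorem stmt2 (C θ : ℝ) (z : ℂ) :
    Matrix.det (z • (1 : Matrix (Fin 3) (Fin 3) ℂ) - Ahat C θ) =
      z^3 + amplA C θ * z^2 - (starRingEnd ℂ) (amplA C θ) * z - 1 := by
  have hE : Complex.exp (Complex.I * θ) = (Real.cos θ : ℂ) + Complex.I * (Real.sin θ : ℂ) := by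
    rw [mul_comm, Complex.exp_mul_I]; push_cast; ring
  have hF : Complex.exp (-(Complex.I * θ)) =
      (Real.cos θ : ℂ) - Complex.I * (Real.sin θ : ℂ) := by
    rw [show -(Complex.I * θ) = (-(θ : ℂ)) * Complex.I by ring, Complex.exp_mul_I,
      Complex.cos_neg, Complex.sin_neg]
    push_cast; ring
  have hconj : (starRingEnd ℂ) (amplA C θ) =
      -(1/3 : ℂ) * (1 - 4 * (C : ℂ)^2 + 4 * ((C : ℂ)^2 - 1) * (Real.cos θ : ℂ)
    + 6 * Complex.I * (C : ℂ) * (Real.sin θ : ℂ)) := by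
    simp only [amplA, map_mul, map_sub, map_add, map_neg, map_div₀, map_one, map_pow,
      Complex.conj_ofReal, Complex.conj_I, map_ofNat]
    ring
  have hEF : ((Real.cos θ : ℂ) + Complex.I * (Real.sin θ : ℂ)) *
      ((Real.cos θ : ℂ) - Complex.I * (Real.sin θ : ℂ)) = 1 := by
    rw [← hE, ← hF, ← Complex.exp_add]; simp
  rw [hconj]
  unfold Ahat Dmat
  rw [Mmat_inv_eq, hE, hF]
  unfold Mmat Rmat amplA
  generalize (Real.cos θ : ℂ) = c at *
  have hw : 6 * Complex.I * (C : ℂ) * (Real.sin θ : ℂ)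
    = 6 * (C : ℂ) * (Complex.I * (Real.sin θ : ℂ)) := by ring
  rw [hw]
  generalize Complex.I * (Real.sin θ : ℂ) = w at *
  generalize (C : ℂ) = C at *
  have hD : (Matrix.diagonal ![1, c - w, c + w] : Matrix (Fin 3) (Fin 3) ℂ) =
      !![1, 0, 0; 0, c - w, 0; 0, 0, c + w] := by
    ext i j
    fin_cases i <;> fin_cases j <;> simp
  rw [hD, Matrix.det_fin_three]
  simp [Matrix.mul_apply, Fin.sum_univ_three]
  linear_combination (z * (-4*C^2/3 + 1/3) - 1) * hEF
end

section
/- Let C ∈ ℝ with |C| < 1/2. For θ ∈ ℝ set Â(θ) := M · D(θ) · M⁻¹ · R, where M = [[1,1,1],[0,1,−1],[−2,1,1]], D(θ) = diag(1, e^{−Iθ}, e^{Iθ}), and R = [[1,0,0],[2C,−1,0],[2(2C²−1),0,−1]]. Then the lattice Boltzmann scheme is stable: there exists K > 0 such that for every θ ∈ [−π, π] and every n ∈ ℕ, ‖Â(θ)ⁿ‖ ≤ K (operator norm). -/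
/-- The operator norm (ℓ²→ℓ² norm) of a complex square matrix. -/
noncomputable def matrixOpNorm {m : ℕ} (A : Matrix (Fin m) (Fin m) ℂ) : ℝ :=
  ‖Matrix.toEuclideanCLM (𝕜 := ℂ) A‖

/-- Reflection `2 s sᵀ - 1`. -/
noncomputable def Jref (a b c : ℝ) : Matrix (Fin 3) (Fin 3) ℂ :=
  !![2*(a:ℂ)*a-1, 2*(a:ℂ)*b, 2*(a:ℂ)*c;
     2*(b:ℂ)*a, 2*(b:ℂ)*b-1, 2*(b:ℂ)*c;
     2*(c:ℂ)*a, 2*(c:ℂ)*b, 2*(c:ℂ)*c-1]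

lemma det_Mmat : IsUnit Mmat.det := by
  rw [isUnit_iff_ne_zero, Mmat, Matrix.det_fin_three]
  simp
  norm_num

lemma Jref_unitary (a b c : ℝ) (h : a^2+b^2+c^2 = 1) :
    star (Jref a b c) * Jref a b c = 1 := by
  have h' : (c:ℂ)^2 = 1 - a^2 - b^2 := by
    have : c^2 = 1 - a^2 - b^2 := by linarith
    exact_mod_cast this
  have h2 : (starRingEnd ℂ) 2 = 2 := Complex.conj_ofNat 2
  ext i j
  fin_cases i <;> fin_cases j <;>
    simp [Jref, Matrix.mul_apply, Fin.sum_univ_three, Matrix.star_apply, h2] <;>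
    ring_nf <;> grind

lemma Dmat_unitary (θ : ℝ) : star (Dmat θ) * Dmat θ = 1 := by
  rw [Dmat, Matrix.star_eq_conjTranspose, Matrix.diagonal_conjTranspose, Matrix.diagonal_mul_diagonal,
    ← Matrix.diagonal_one]
  congr 1
  ext i
  fin_cases i <;> simp [← Complex.exp_conj, ← Complex.exp_add]

lemma R_M (C a b c : ℝ) (ha : a^2 = 2*(1-C^2)/3) (hb : b^2 = (1+C)*(1+2*C)/6)
    (hc : c^2 = (1-C)*(1-2*C)/6) :
    Rmat C * (Mmat * Matrix.diagonal ![(a:ℂ),b,c]) =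
      Mmat * Matrix.diagonal ![(a:ℂ),b,c] * Jref a b c := by
  have ha' : (a:ℂ)^2 = 2*(1-C^2)/3 := by exact_mod_cast congrArg (fun x : ℝ => (x:ℂ)) ha
  have hb' : (b:ℂ)^2 = (1+C)*(1+2*C)/6 := by exact_mod_cast congrArg (fun x : ℝ => (x:ℂ)) hb
  have hc' : (c:ℂ)^2 = (1-C)*(1-2*C)/6 := by exact_mod_cast congrArg (fun x : ℝ => (x:ℂ)) hc
  have hd : Matrix.diagonal ![(a:ℂ),b,c] = !![(a:ℂ),0,0;0,b,0;0,0,c] := by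
    ext i j
    fin_cases i <;> fin_cases j <;> simp
  rw [hd]
  ext i j
  fin_cases i <;> fin_cases j <;>
    simp [Jref, Rmat, Mmat, Matrix.mul_apply, Fin.sum_univ_three] <;>
    grind

/-- Under the CFL condition `|C| < 1/2`, the lattice Boltzmann scheme is stable: its Fourier
symbol is uniformly power bounded over all frequencies. -/
theorem stmt3 (C : ℝ) (hC : |C| < 1/2) :
    ∃ K > 0, ∀ θ ∈ Set.Icc (-Real.pi) Real.pi, ∀ n : ℕ,
      matrixOpNorm (Ahat C θ ^ n) ≤ K := by
  obtain ⟨h1, h2⟩ := abs_lt.mp hC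
  have wa : 0 < 2*(1-C^2)/3 := by nlinarith
  have wb : 0 < (1+C)*(1+2*C)/6 := by nlinarith
  have wc : 0 < (1-C)*(1-2*C)/6 := by nlinarith
  obtain ⟨a, ha0, ha⟩ : ∃ a : ℝ, 0 < a ∧ a^2 = 2*(1-C^2)/3 :=
    ⟨_, Real.sqrt_pos.mpr wa, Real.sq_sqrt wa.le⟩
  obtain ⟨b, hb0, hb⟩ : ∃ a : ℝ, 0 < a ∧ a^2 = (1+C)*(1+2*C)/6 :=
    ⟨_, Real.sqrt_pos.mpr wb, Real.sq_sqrt wb.le⟩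
  obtain ⟨c, hc0, hc⟩ : ∃ a : ℝ, 0 < a ∧ a^2 = (1-C)*(1-2*C)/6 :=
    ⟨_, Real.sqrt_pos.mpr wc, Real.sq_sqrt wc.le⟩
  have hsum : a^2+b^2+c^2 = 1 := by rw [ha, hb, hc]; ring
  set S : Matrix (Fin 3) (Fin 3) ℂ := Matrix.diagonal ![(a:ℂ),b,c] with hS
  set T := Mmat * S with hT
  have hdet : IsUnit T.det := by
    rw [hT, Matrix.det_mul]
    refine det_Mmat.mul ?_
    rw [isUnit_iff_ne_zero, hS, Matrix.det_diagonal, Fin.prod_univ_three]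
    simp [ha0.ne', hb0.ne', hc0.ne']
  let Φ := Matrix.toEuclideanCLM (n := Fin 3) (𝕜 := ℂ)
  refine ⟨‖Φ T‖ * ‖Φ T⁻¹‖ + 1, by positivity, fun θ _ n => ?_⟩
  set U := Dmat θ * Jref a b c with hU
  have hUu : star U * U = 1 := by
    rw [hU, star_mul, mul_assoc, ← mul_assoc (star (Dmat θ)), Dmat_unitary, one_mul,
      Jref_unitary a b c hsum]
  have hcomm : Dmat θ * S = S * Dmat θ := by
    rw [Dmat, hS, Matrix.diagonal_mul_diagonal, Matrix.diagonal_mul_diagonal]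
    congr 1; ext i; exact mul_comm _ _
  have hAT : Ahat C θ * T = T * U := by
    calc Ahat C θ * T = Mmat * Dmat θ * Mmat⁻¹ * (Rmat C * T) := by
          rw [Ahat, mul_assoc]
      _ = Mmat * Dmat θ * (Mmat⁻¹ * Mmat) * S * Jref a b c := by
          rw [hT, hS, R_M C a b c ha hb hc]; simp only [mul_assoc]
      _ = Mmat * (Dmat θ * S) * Jref a b c := by
          rw [Matrix.nonsing_inv_mul _ det_Mmat]; simp only [mul_assoc, mul_one, one_mul]
      _ = T * U := by rw [hcomm, hT, hU]; simp only [mul_assoc]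
  have hn : Ahat C θ ^ n * T = T * U ^ n := by
    have : SemiconjBy T U (Ahat C θ) := hAT.symm
    exact (this.pow_right n).symm
  have hAn : Ahat C θ ^ n = T * U ^ n * T⁻¹ := by
    rw [← hn, mul_assoc, Matrix.mul_nonsing_inv _ hdet, mul_one]
  have hUn : ‖Φ (U ^ n)‖ ≤ 1 := by
    have hmem : U ∈ unitary (Matrix (Fin 3) (Fin 3) ℂ) :=
      ⟨hUu, mul_eq_one_comm.mp hUu⟩
    have h2 : star (U ^ n) * U ^ n = 1 := (pow_mem hmem n).1
    have h3 : star (Φ (U ^ n)) * Φ (U ^ n) = 1 := by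
      rw [← map_star, ← map_mul, h2, map_one]
    have h4 := CStarRing.norm_star_mul_self (x := Φ (U ^ n))
    rw [h3] at h4
    have h5 : ‖(1 : EuclideanSpace ℂ (Fin 3) →L[ℂ] EuclideanSpace ℂ (Fin 3))‖ ≤ 1 :=
      ContinuousLinearMap.norm_id_le
    nlinarith [norm_nonneg (Φ (U ^ n))]
  calc matrixOpNorm (Ahat C θ ^ n) = ‖Φ T * Φ (U ^ n) * Φ T⁻¹‖ := by
        rw [matrixOpNorm, hAn, ← map_mul, ← map_mul]
    _ ≤ ‖Φ T‖ * ‖Φ (U ^ n)‖ * ‖Φ T⁻¹‖ :=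
        (norm_mul_le _ _).trans (mul_le_mul_of_nonneg_right (norm_mul_le _ _) (norm_nonneg _))
    _ ≤ ‖Φ T‖ * 1 * ‖Φ T⁻¹‖ := by gcongr
    _ ≤ _ := by linarith
end

section
/- Let A be the 3 × 3 complex matrix A = [[−1, 1, 1], [1, 0, 0], [0, 1, 0]] (the companion matrix of z³ + z² − z − 1). Then for every m ∈ ℕ, the first row of Aᵐ equals ( (1/4)·(−1)ᵐ·(2m + 3) + 1/4 , (1/2)·(−1)^{m+1} + 1/2 , (1/4)·(−1)^{m+1}·(2m + 1) + 1/4 ). In particular the first and third entries grow linearly in m, so A is not power bounded. -/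
/-- The companion matrix of `z³ + z² − z − 1`. -/
noncomputable def A5 : Matrix (Fin 3) (Fin 3) ℂ := !![-1, 1, 1; 1, 0, 0; 0, 1, 0]

lemma entry_le_opNorm (B : Matrix (Fin 3) (Fin 3) ℂ) : ‖B 0 0‖ ≤ matrixOpNorm B := by
  have h := (Matrix.toEuclideanCLM (𝕜 := ℂ) B).le_opNorm (EuclideanSpace.single 0 1)
  have h2 := PiLp.norm_apply_le
    (Matrix.toEuclideanCLM (𝕜 := ℂ) B (EuclideanSpace.single 0 1)) 0
  have h3 : (Matrix.toEuclideanCLM (𝕜 := ℂ) B (EuclideanSpace.single 0 1)) 0 = B 0 0 := by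
    simp [Matrix.ofLp_toEuclideanCLM]
  rw [h3] at h2
  have h4 : ‖(EuclideanSpace.single 0 1 : EuclideanSpace ℂ (Fin 3))‖ = 1 := by simp
  rw [h4, mul_one] at h
  exact h2.trans h

/-- Explicit formula for the first row of the powers of the companion matrix of
`z³ + z² − z − 1`; its first and third entries grow linearly, so the matrix is not
power bounded. -/
theorem stmt5 :
    (∀ m : ℕ,
      (A5 ^ m) 0 0 = (1/4 : ℂ) * (-1)^m * (2 * (m : ℂ) + 3) + 1/4 ∧
      (A5 ^ m) 0 1 = (1/2 : ℂ) * (-1)^(m+1) + 1/2 ∧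
      (A5 ^ m) 0 2 = (1/4 : ℂ) * (-1)^(m+1) * (2 * (m : ℂ) + 1) + 1/4) ∧
    ¬ ∃ K : ℝ, ∀ n : ℕ, matrixOpNorm (A5 ^ n) ≤ K := by
  have key : ∀ m : ℕ,
      (A5 ^ m) 0 0 = (1/4 : ℂ) * (-1)^m * (2 * (m : ℂ) + 3) + 1/4 ∧
      (A5 ^ m) 0 1 = (1/2 : ℂ) * (-1)^(m+1) + 1/2 ∧
      (A5 ^ m) 0 2 = (1/4 : ℂ) * (-1)^(m+1) * (2 * (m : ℂ) + 1) + 1/4 := by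
    intro m
    induction m with
    | zero =>
      norm_num [Matrix.one_apply]
      decide
    | succ k ih =>
      obtain ⟨h0, h1, h2⟩ := ih
      have e0 : (A5 ^ (k+1)) 0 0 = -(A5 ^ k) 0 0 + (A5 ^ k) 0 1 := by
        rw [pow_succ, Matrix.mul_apply, Fin.sum_univ_three]
        simp [A5]
      have e1 : (A5 ^ (k+1)) 0 1 = (A5 ^ k) 0 0 + (A5 ^ k) 0 2 := by
        rw [pow_succ, Matrix.mul_apply, Fin.sum_univ_three]
        simp [A5]
      have e2 : (A5 ^ (k+1)) 0 2 = (A5 ^ k) 0 0 := by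
        rw [pow_succ, Matrix.mul_apply, Fin.sum_univ_three]
        simp [A5]
      rw [e0, e1, e2, h0, h1, h2]
      push_cast
      refine ⟨?_, ?_, ?_⟩ <;> ring
  refine ⟨key, ?_⟩
  rintro ⟨K, hK⟩
  obtain ⟨k, hk⟩ := exists_nat_gt K
  have hb := (entry_le_opNorm (A5 ^ (2 * k))).trans (hK (2 * k))
  have he : (A5 ^ (2 * k)) 0 0 = ((k + 1 : ℝ) : ℂ) := by
    rw [(key (2 * k)).1, pow_mul]
    push_cast
    norm_num
    ring
  rw [he, Complex.norm_real, Real.norm_eq_abs] at hb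
  have := le_abs_self (k + 1 : ℝ)
  linarith
end

section
/- For every real C with −1 < C < 1, the two conditions (√3/6)·(√3·C + √(8 − 5C²)) < 1 and (√3/6)·(√3·C − √(8 − 5C²)) > −1 hold simultaneously if and only if |C| < 1/2. -/
/-- The parasitic-mode velocities are both smaller than the scheme's speed of information
if and only if `|C| < 1/2`. -/
theorem stmt13 (C : ℝ) (h1 : -1 < C) (h2 : C < 1) :
    ((Real.sqrt 3 / 6) * (Real.sqrt 3 * C + Real.sqrt (8 - 5 * C^2)) < 1 ∧
     (Real.sqrt 3 / 6) * (Real.sqrt 3 * C - Real.sqrt (8 - 5 * C^2)) > -1) ↔ |C| < 1/2 := by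
  have hw : 0 ≤ 8 - 5 * C^2 := by nlinarith
  have ht0 : 0 ≤ Real.sqrt 3 * Real.sqrt (8 - 5 * C^2) := by positivity
  have h3 : Real.sqrt 3 * Real.sqrt 3 = 3 := Real.mul_self_sqrt (by norm_num)
  have ht : (Real.sqrt 3 * Real.sqrt (8 - 5 * C^2))^2 = 24 - 15 * C^2 := by
    rw [mul_pow, Real.sq_sqrt hw, Real.sq_sqrt (by norm_num)]; ring
  have e1 : (Real.sqrt 3 / 6) * (Real.sqrt 3 * C + Real.sqrt (8 - 5 * C^2))
      = (3 * C + Real.sqrt 3 * Real.sqrt (8 - 5 * C^2)) / 6 := by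
    linear_combination (C / 6) * h3
  have e2 : (Real.sqrt 3 / 6) * (Real.sqrt 3 * C - Real.sqrt (8 - 5 * C^2))
      = (3 * C - Real.sqrt 3 * Real.sqrt (8 - 5 * C^2)) / 6 := by
    linear_combination (C / 6) * h3
  rw [e1, e2, abs_lt]
  generalize Real.sqrt 3 * Real.sqrt (8 - 5 * C^2) = t at ht0 ht
  constructor
  · rintro ⟨ha, hb⟩
    have ha' : t < 6 - 3 * C := by linarith
    have hb' : t < 6 + 3 * C := by linarith
    have qa : t^2 < (6 - 3 * C)^2 := pow_lt_pow_left₀ ha' ht0 (by norm_num)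
    have qb : t^2 < (6 + 3 * C)^2 := pow_lt_pow_left₀ hb' ht0 (by norm_num)
    constructor <;> nlinarith
  · rintro ⟨ha, hb⟩
    have qa : t < 6 - 3 * C := by
      apply lt_of_pow_lt_pow_left₀ 2 (by linarith)
      nlinarith [mul_pos (sub_pos.2 hb) (sub_pos.2 h2)]
    have qb : t < 6 + 3 * C := by
      apply lt_of_pow_lt_pow_left₀ 2 (by linarith)
      nlinarith [mul_pos (sub_pos.2 ha) (sub_pos.2 h1)]
    constructor <;> linarith
end
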